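/- Let d be a positive integer. There exists a positive integer n_0, depending only on r, k, the weight vectors w_1,…,w_k and d (and not on n), such that for every positive integer n and any two invariant multi-homogeneous monomials f and g of degree d in ℂ[x_{ij} : 1 ≤ i ≤ n, 1 ≤ j ≤ k], there exists a finite sequence f = m_0, m_1, …, m_L = g of invariant multi-homogeneous monomials of degree d such that for each ℓ ∈ {1,…,L}, the monomials m_{ℓ−1} and m_ℓ have identical exponents in all but at most n_0 of the rows; that is, the set of indices i ∈ {1,…,n} for which the exponent vectors (e_{m_{ℓ−1}}(i,1),…,e_{m_{ℓ−1}}(i,k)) and (e_{m_ℓ}(i,1),…,e_{m_ℓ}(i,k)) differ has cardinality at most n_0. -/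

import Mathlib

/-- `e` is the exponent function of a multi-homogeneous monomial of degree `d`:
every row has total degree `d`. -/
def MultiHomog (n k d : ℕ) (e : Fin n × Fin k → ℕ) : Prop :=
  ∀ i : Fin n, ∑ j, e (i, j) = d

/-- `e` is the exponent function of a monomial invariant under the torus action with
weights `w`. -/
def InvariantMon (r n k : ℕ) (w : Fin k → Fin r → ℤ) (e : Fin n × Fin k → ℕ) : Prop :=
  ∑ i, ∑ j, (e (i, j) : ℤ) • w j = 0

/-- Among nonempty zero-sum families with entries in a fixed finite set, a nonempty zero-sum
subfamily can be chosen whose size is bounded in terms of the finite set only. -/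
theorem Set.Finite.exists_bounded_zero_sum_subset {M : Type*} [AddCommMonoid M] {V : Set M}
    (hV : V.Finite) :
    ∃ N : ℕ, ∀ {ι : Type*} (S : Finset ι) (t : ι → M), (∀ i, t i ∈ V) → S.Nonempty →
      ∑ i ∈ S, t i = 0 → ∃ T ⊆ S, T.Nonempty ∧ T.card ≤ N ∧ ∑ i ∈ T, t i = 0 := by
  classical
  have := hV.fintype
  let A : (V → ℕ) → Prop := fun c ↦ c ≠ 0 ∧ ∑ v, c v • (v : M) = 0
  have hfin : {c | Minimal A c}.Finite :=
    WellQuasiOrderedLE.finite_of_isAntichain (setOfPred_minimal_antichain A)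
  obtain ⟨N, hN⟩ := (hfin.image fun c ↦ ∑ v, c v).bddAbove
  refine ⟨N, fun {ι} S t ht hS hsum ↦ ?_⟩
  let s : ι → V := fun i ↦ ⟨t i, ht i⟩
  have sum_fibers (T : Finset ι) :
      ∑ v, (T.filter fun i ↦ s i = v).card • (v : M) = ∑ i ∈ T, t i := by
    rw [← Finset.sum_fiberwise T s t]
    refine Finset.sum_congr rfl fun v _ ↦ ?_
    rw [← Finset.sum_const]
    refine Finset.sum_congr rfl fun i hi ↦ ?_
    rw [← (Finset.mem_filter.1 hi).2]
  have card_fibers (T : Finset ι) : T.card = ∑ v, (T.filter fun i ↦ s i = v).card :=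
    Finset.card_eq_sum_card_fiberwise fun _ _ ↦ Finset.mem_coe.2 (Finset.mem_univ _)
  have hA : A fun v ↦ (S.filter fun i ↦ s i = v).card := by
    refine ⟨fun h ↦ hS.card_pos.ne' ?_, (sum_fibers S).trans hsum⟩
    rw [card_fibers S]
    exact Finset.sum_eq_zero fun v _ ↦ congrFun h v
  obtain ⟨b, hb, hbmin⟩ := exists_minimal_le_of_wellFoundedLT A _ hA
  choose F hFS hFcard using fun v ↦ Finset.exists_subset_card_eq (hb v)
  let T := S.filter fun i ↦ i ∈ F (s i)
  have hT (v : V) : (T.filter fun i ↦ s i = v).card = b v := by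
    rw [← hFcard v]
    congr 1
    ext i
    have := @hFS v i
    simp only [T, Finset.mem_filter] at this ⊢
    grind
  have hTcard : T.card = ∑ v, b v := by simp only [card_fibers T, hT]
  refine ⟨T, Finset.filter_subset _ _, ?_, ?_, ?_⟩
  · rw [← Finset.card_pos, hTcard]
    refine Nat.pos_of_ne_zero fun h ↦ hbmin.prop.1 ?_
    ext v
    exact Finset.sum_eq_zero_iff.1 h v (Finset.mem_univ v)
  · rw [hTcard]
    exact hN ⟨b, hbmin, rfl⟩
  · simpa only [hT, hbmin.prop.2] using (sum_fibers T).symm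

theorem Relation.ReflTransGen.exists_fin_chain {α : Type*} {R : α → α → Prop} {a b : α}
    (h : Relation.ReflTransGen R a b) :
    ∃ (L : ℕ) (m : Fin (L + 1) → α), m 0 = a ∧ m (Fin.last L) = b ∧
      ∀ l : Fin L, R (m l.castSucc) (m l.succ) := by
  induction h using Relation.ReflTransGen.head_induction_on with
  | refl => exact ⟨0, fun _ ↦ b, rfl, rfl, fun l ↦ l.elim0⟩
  | @head a c hac _ ih =>
    obtain ⟨L, m, rfl, rfl, hm⟩ := ih
    refine ⟨L + 1, Fin.cons a m, rfl, ?_, fun l ↦ ?_⟩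
    · rw [← Fin.succ_last, Fin.cons_succ]
    · cases l using Fin.cases with
      | zero => simpa using hac
      | succ l => simpa [← Fin.succ_castSucc] using hm l

section RowSwaps

variable {r n k d : ℕ} {w : Fin k → Fin r → ℤ}

/-- The weight vector of a row with exponents `a`. -/
def rowWeight (w : Fin k → Fin r → ℤ) (a : Fin k → ℕ) : Fin r → ℤ :=
  ∑ j, (a j : ℤ) • w j

/-- The exponent function which agrees with `g` on the rows in `T` and with `f` elsewhere. -/
def swapRows (T : Finset (Fin n)) (f g : Fin n × Fin k → ℕ) : Fin n × Fin k → ℕ :=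
  fun p ↦ if p.1 ∈ T then g p else f p

/-- The rows in which `f` and `g` differ. -/
def diffRows (f g : Fin n × Fin k → ℕ) : Finset (Fin n) :=
  Finset.univ.filter fun i ↦ ∃ j, f (i, j) ≠ g (i, j)

theorem MultiHomog.swapRows {f g : Fin n × Fin k → ℕ} (hf : MultiHomog n k d f)
    (hg : MultiHomog n k d g) (T : Finset (Fin n)) : MultiHomog n k d (swapRows T f g) := by
  intro i
  by_cases hi : i ∈ T
  · simpa [_root_.swapRows, hi] using hg i
  · simpa [_root_.swapRows, hi] using hf i

theorem InvariantMon.swapRows {f g : Fin n × Fin k → ℕ} (hf : InvariantMon r n k w f)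
    {T : Finset (Fin n)}
    (hT : ∑ i ∈ T, (rowWeight w (fun j ↦ g (i, j)) - rowWeight w fun j ↦ f (i, j)) = 0) :
    InvariantMon r n k w (swapRows T f g) := by
  have key (i : Fin n) : rowWeight w (fun j ↦ _root_.swapRows T f g (i, j)) =
      rowWeight w (fun j ↦ f (i, j)) + if i ∈ T then
        rowWeight w (fun j ↦ g (i, j)) - rowWeight w (fun j ↦ f (i, j)) else 0 := by
    by_cases hi : i ∈ T <;> simp [_root_.swapRows, hi]
  change ∑ i, rowWeight w (fun j ↦ _root_.swapRows T f g (i, j)) = 0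
  simp only [key, Finset.sum_add_distrib, Finset.sum_ite_mem, Finset.univ_inter, hT, add_zero]
  exact hf

theorem exists_bound_reflTransGen_rowSwaps (w : Fin k → Fin r → ℤ) (d : ℕ) :
    ∃ N : ℕ, ∀ (n : ℕ)
      (f g : {e : Fin n × Fin k → ℕ // MultiHomog n k d e ∧ InvariantMon r n k w e}),
      Relation.ReflTransGen (fun a b ↦ (diffRows a.1 b.1).card ≤ N) f g := by
  let B : Set (Fin k → ℕ) := Set.Iic fun _ ↦ d
  have hB : B.Finite := Set.finite_Iic _
  obtain ⟨N, hN⟩ := ((hB.prod hB).image fun p ↦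
    rowWeight w p.2 - rowWeight w p.1).exists_bounded_zero_sum_subset
  refine ⟨N, fun n f g ↦ ?_⟩
  have mem_B {e : Fin n × Fin k → ℕ} (he : MultiHomog n k d e) (i : Fin n) :
      (fun j ↦ e (i, j)) ∈ B := fun j ↦
    (Finset.single_le_sum (f := fun j ↦ e (i, j)) (fun _ _ ↦ Nat.zero_le _)
      (Finset.mem_univ j)).trans (he i).le
  induction hc : (diffRows f.1 g.1).card using Nat.strong_induction_on generalizing f with
  | _ c ih =>
    subst hc
    obtain hempty | hne := (diffRows f.1 g.1).eq_empty_or_nonempty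
    · have : f = g := by
        ext ⟨i, j⟩
        by_contra h
        exact Finset.notMem_empty i (hempty ▸ Finset.mem_filter.2 ⟨Finset.mem_univ i, j, h⟩)
      rw [this]
    have hsum : ∑ i ∈ diffRows f.1 g.1,
        (rowWeight w (fun j ↦ g.1 (i, j)) - rowWeight w fun j ↦ f.1 (i, j)) = 0 := by
      rw [Finset.sum_subset (Finset.subset_univ _), Finset.sum_sub_distrib]
      · exact sub_eq_zero.2 (g.2.2.trans f.2.2.symm)
      · intro i _ hi
        simp only [diffRows, Finset.mem_filter, Finset.mem_univ, true_and, not_exists,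
          not_not] at hi
        simp [hi]
    obtain ⟨T, hTS, hTne, hTN, hT⟩ := hN _ _
      (fun i ↦ ⟨(_, _), ⟨mem_B f.2.1 i, mem_B g.2.1 i⟩, rfl⟩) hne hsum
    refine .head (b := ⟨swapRows T f.1 g.1, f.2.1.swapRows g.2.1 T, f.2.2.swapRows hT⟩) ?_
      (ih _ ?_ _ rfl)
    · refine (Finset.card_le_card fun i hi ↦ ?_).trans hTN
      by_contra h
      simp [diffRows, swapRows, h] at hi
    · refine Finset.card_lt_card ⟨fun i hi ↦ ?_, fun h ↦ ?_⟩
      · by_cases hiT : i ∈ T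
        · exact hTS hiT
        · simpa [diffRows, swapRows, hiT] using hi
      · obtain ⟨i, hi⟩ := hTne
        have := h (hTS hi)
        simp [diffRows, swapRows, hi] at this

end RowSwaps

/-- Fix weights `w_1, …, w_k ∈ ℤ^r` and a degree `d`. There is an
`n₀` (independent of `n`) such that any two invariant multi-homogeneous monomials of
degree `d` in `ℂ[x_{ij}]` are connected by a chain of invariant multi-homogeneous
monomials of degree `d` in which consecutive monomials differ in at most `n₀` rows. -/
theorem invariant_monomials_connected_by_bounded_row_swaps
    (r k : ℕ) (hr : 0 < r) (hk : 0 < k) (w : Fin k → Fin r → ℤ)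
    (d : ℕ) (hd : 0 < d) :
    ∃ n₀ : ℕ, 0 < n₀ ∧
      ∀ n : ℕ, 0 < n →
        ∀ f g : Fin n × Fin k → ℕ,
          MultiHomog n k d f → InvariantMon r n k w f →
          MultiHomog n k d g → InvariantMon r n k w g →
          ∃ (L : ℕ) (m : Fin (L + 1) → (Fin n × Fin k → ℕ)),
            m 0 = f ∧ m (Fin.last L) = g ∧
            (∀ ℓ : Fin (L + 1), MultiHomog n k d (m ℓ) ∧ InvariantMon r n k w (m ℓ)) ∧
            (∀ ℓ : Fin L,
              Set.ncard {i : Fin n | ∃ j : Fin k,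
                m ℓ.castSucc (i, j) ≠ m ℓ.succ (i, j)} ≤ n₀) := by
  obtain ⟨N, hN⟩ := exists_bound_reflTransGen_rowSwaps w d
  refine ⟨N + 1, N.succ_pos, fun n _ f g hf hf' hg hg' ↦ ?_⟩
  obtain ⟨L, m, h0, hL, hm⟩ := (hN n ⟨f, hf, hf'⟩ ⟨g, hg, hg'⟩).exists_fin_chain
  refine ⟨L, fun l ↦ (m l).1, congrArg Subtype.val h0, congrArg Subtype.val hL,
    fun l ↦ (m l).2, fun l ↦ ?_⟩
  have := hm l
  rw [← Set.ncard_coe_finset] at this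
  exact (by simpa [diffRows] using this : _ ≤ N).trans N.le_succ
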